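/- Fix N ≥ 1, k > 0 and h > 0, with vectors indexed cyclically by j ∈ ℤ/Nℤ. Let G : ℝ^N → ℝ^N be differentiable with each component G_j convex, each partial derivative ∂G_i/∂u_j locally Lipschitz, satisfying the numerical Poincaré inequality: there exists ϱ > 0 such that for all U, V ∈ ℝ^N, Σ_j ((u_j − u_{j+1})/h − (v_j − v_{j+1})/h)² ≤ ϱ Σ_j (G_j(U) − G_j(V) − ⟨∇G_j(V), U − V⟩), and satisfying translation invariance: G_j(U + s·𝟙) = G_j(U) for all U, s, j. Suppose (M*, U*) ∈ ℝ^N × ℝ^N satisfies F̃(M*, U*) = 0 with all m*_j > 0 and (1/N)Σ_j m*_j = 1. Then for every initial condition (M⁰, U⁰) with all m⁰_j > 0, (1/N)Σ_j m⁰_j = 1 and Σ_j u⁰_j = Σ_j u*_j, the discrete Hessian Riemannian flow (Ṁ, U̇) = −F̄(M, U), (M(0), U(0)) = (M⁰, U⁰), admits a unique solution (M(t), U(t)) on [0, +∞) with all m_j(t) > 0, and for each j, u_j(t) → u*_j and m_j(t) → m*_j as t → ∞. -/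

import Mathlib

open Filter

/-- The discrete entropy-penalized effective Hamiltonian
`H̃(M,U) = (∑ᵢ (mᵢ Gᵢ(U) − (1/k) mᵢ ln mᵢ)) / (∑ᵢ mᵢ)`, cyclic indexing. -/
noncomputable def Htilde {N : ℕ} [NeZero N] (k : ℝ)
    (G : (ZMod N → ℝ) → (ZMod N → ℝ)) (M U : ZMod N → ℝ) : ℝ :=
  (∑ i, (M i * G U i - (1 / k) * (M i * Real.log (M i)))) / ∑ i, M i

/-- First block of `F̃(M,U)`: `(−Gᵢ(U) + H̃(M,U) + (1/k) ln mᵢ)ᵢ`. -/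
noncomputable def Ftilde1 {N : ℕ} [NeZero N] (k : ℝ)
    (G : (ZMod N → ℝ) → (ZMod N → ℝ)) (M U : ZMod N → ℝ) (i : ZMod N) : ℝ :=
  -(G U i) + Htilde k G M U + (1 / k) * Real.log (M i)

/-- Second block of `F̃(M,U)` (and of `F̄(M,U)`): the vector `DG(U)ᵀ M`. -/
noncomputable def Ftilde2 {N : ℕ} [NeZero N]
    (G : (ZMod N → ℝ) → (ZMod N → ℝ)) (M U : ZMod N → ℝ) (j : ZMod N) : ℝ :=
  ∑ i, M i * (fderiv ℝ G U) (Pi.single j 1) i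

/-- First block of `F̄(M,U)`: `(mᵢ(−Gᵢ(U) + H̃(M,U) + (1/k) ln mᵢ))ᵢ`. -/
noncomputable def Fbar1 {N : ℕ} [NeZero N] (k : ℝ)
    (G : (ZMod N → ℝ) → (ZMod N → ℝ)) (M U : ZMod N → ℝ) (i : ZMod N) : ℝ :=
  M i * Ftilde1 k G M U i

lemma hrf_locLip_pi {α : Type*} [PseudoEMetricSpace α] {ι : Type*} [Fintype ι] {β : Type*} [PseudoEMetricSpace β]
    {f : α → ι → β} (hf : ∀ i, LocallyLipschitz (fun x => f x i)) : LocallyLipschitz f := by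
  intro x
  choose K t ht hK using fun i => hf i x
  refine ⟨∑ i, K i, ⋂ i, t i, Filter.iInter_mem.2 ht, ?_⟩
  intro a ha b hb
  rw [edist_pi_le_iff]
  intro i
  have h1 := hK i (Set.mem_iInter.1 ha i) (Set.mem_iInter.1 hb i)
  refine h1.trans ?_
  gcongr
  exact Finset.single_le_sum (f := K) (fun _ _ => zero_le) (Finset.mem_univ i)

lemma hrf_locLip_smul {E F : Type*} [NormedAddCommGroup E] [NormedSpace ℝ E]
    [NormedAddCommGroup F] [NormedSpace ℝ F] {c : E → ℝ} {v : E → F}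
    (hc : LocallyLipschitz c) (hv : LocallyLipschitz v) : LocallyLipschitz (fun y => c y • v y) := by
  have hs : ContDiff ℝ 1 (fun z : ℝ × F => z.1 • z.2) := by fun_prop
  exact hs.locallyLipschitz.comp (hc.prodMk hv)

lemma hrf_ode_unique_right {E : Type*} [NormedAddCommGroup E] [NormedSpace ℝ E]
    {w : E → E} (hw : LocallyLipschitz w) {f g : ℝ → E}
    (hf : ∀ t, 0 ≤ t → HasDerivAt f (w (f t)) t) (hg : ∀ t, 0 ≤ t → HasDerivAt g (w (g t)) t)
    (h0 : f 0 = g 0) : ∀ t, 0 ≤ t → f t = g t := by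
  intro T hT
  have cf : ContinuousOn f (Set.Icc 0 T) := fun t ht => (hf t ht.1).continuousAt.continuousWithinAt
  have cg : ContinuousOn g (Set.Icc 0 T) := fun t ht => (hg t ht.1).continuousAt.continuousWithinAt
  obtain ⟨K, hK⟩ := (hw.locallyLipschitzOn (s := f '' Set.Icc 0 T ∪ g '' Set.Icc 0 T)).exists_lipschitzOnWith_of_compact
    ((isCompact_Icc.image_of_continuousOn cf).union (isCompact_Icc.image_of_continuousOn cg))
  exact ODE_solution_unique_of_mem_Icc_right (v := fun _ => w) (s := fun _ => f '' Set.Icc 0 T ∪ g '' Set.Icc 0 T)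
    (fun _ _ => hK) cf (fun t ht => (hf t ht.1).hasDerivWithinAt)
    (fun t ht => Or.inl ⟨t, Set.Ico_subset_Icc_self ht, rfl⟩) cg
    (fun t ht => (hg t ht.1).hasDerivWithinAt)
    (fun t ht => Or.inr ⟨t, Set.Ico_subset_Icc_self ht, rfl⟩) h0 (Set.right_mem_Icc.2 hT)

lemma hrf_ode_unique_Ioo {E : Type*} [NormedAddCommGroup E] [NormedSpace ℝ E]
    {w : E → E} (hw : LocallyLipschitz w) {f g : ℝ → E} {R : ℝ}
    (hf : ∀ t ∈ Set.Ioo (-R) R, HasDerivAt f (w (f t)) t)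
    (hg : ∀ t ∈ Set.Ioo (-R) R, HasDerivAt g (w (g t)) t)
    (h0 : f 0 = g 0) : ∀ t ∈ Set.Ioo (-R) R, f t = g t := by
  intro T hT
  obtain ⟨b, hb1, hb2⟩ := exists_between (abs_lt.2 hT)
  have hb := abs_lt.1 hb1
  have hsub : Set.Icc (-b) b ⊆ Set.Ioo (-R) R := fun t ht => ⟨by linarith [ht.1], by linarith [ht.2]⟩
  have cf : ContinuousOn f (Set.Icc (-b) b) := fun t ht => (hf t (hsub ht)).continuousAt.continuousWithinAt
  have cg : ContinuousOn g (Set.Icc (-b) b) := fun t ht => (hg t (hsub ht)).continuousAt.continuousWithinAt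
  obtain ⟨K, hK⟩ := (hw.locallyLipschitzOn (s := f '' Set.Icc (-b) b ∪ g '' Set.Icc (-b) b)).exists_lipschitzOnWith_of_compact
    ((isCompact_Icc.image_of_continuousOn cf).union (isCompact_Icc.image_of_continuousOn cg))
  have hbpos : 0 < b := (abs_nonneg _).trans_lt hb1
  have hsub2 : Set.Ioo (-b) b ⊆ Set.Icc (-b) b := Set.Ioo_subset_Icc_self
  exact ODE_solution_unique_of_mem_Ioo (v := fun _ => w) (s := fun _ => f '' Set.Icc (-b) b ∪ g '' Set.Icc (-b) b)
    (t₀ := 0) (fun _ _ => hK) ⟨by linarith, hbpos⟩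
    (fun t ht => ⟨hf t (hsub (hsub2 ht)), Or.inl ⟨t, hsub2 ht, rfl⟩⟩)
    (fun t ht => ⟨hg t (hsub (hsub2 ht)), Or.inr ⟨t, hsub2 ht, rfl⟩⟩) h0 hb

lemma hrf_ode_global {E : Type*} [NormedAddCommGroup E] [NormedSpace ℝ E] [ProperSpace E]
    {w : E → E} (hw : LocallyLipschitz w) (L : NNReal) (hL : ∀ x, ‖w x‖ ≤ L) (x0 : E) :
    ∃ y : ℝ → E, y 0 = x0 ∧ ∀ t, HasDerivAt y (w (y t)) t := by
  have key : ∀ R : NNReal, 0 < R → ∃ y : ℝ → E, y 0 = x0 ∧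
      ∀ t ∈ Set.Ioo (-(R:ℝ)) R, HasDerivAt y (w (y t)) t := by
    intro R hR
    have hR' : (0:ℝ) < R := hR
    obtain ⟨K, hK⟩ := (hw.locallyLipschitzOn (s := Metric.closedBall x0 (L * R : NNReal))).exists_lipschitzOnWith_of_compact
      (isCompact_closedBall _ _)
    have hp : IsPicardLindelof (fun _ => w) (tmin := -(R:ℝ)) (tmax := R) ⟨0, by constructor <;> linarith⟩ x0
        (L * R) 0 L K :=
      { lipschitzOnWith := fun _ _ => hK
        continuousOn := fun _ _ => continuousOn_const
        norm_le := fun _ _ x _ => hL x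
        mul_max_le := by simp }
    obtain ⟨y, h0, hy⟩ := hp.exists_eq_forall_mem_Icc_hasDerivWithinAt₀
    exact ⟨y, h0, fun t ht => (hy t (Set.Ioo_subset_Icc_self ht)).hasDerivAt (Icc_mem_nhds ht.1 ht.2)⟩
  choose! y hy0 hy using fun n : ℕ => key (n + 1) (by positivity)
  have hy' : ∀ n : ℕ, ∀ t, |t| < (n:ℝ) + 1 → HasDerivAt (y n) (w (y n t)) t := by
    intro n t ht
    apply hy
    simpa [abs_lt] using ht
  have hcomp : ∀ n m : ℕ, n ≤ m → ∀ t, |t| < (n:ℝ) + 1 → y n t = y m t := by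
    intro n m hnm t ht
    have : (n:ℝ) ≤ m := by exact_mod_cast hnm
    exact hrf_ode_unique_Ioo hw (R := (n:ℝ)+1) (fun s hs => hy' n s (abs_lt.2 hs))
      (fun s hs => hy' m s ((abs_lt.2 hs).trans_le (by linarith)))
      ((hy0 n).trans (hy0 m).symm) t (abs_lt.1 ht)
  have hcomp2 : ∀ n m : ℕ, ∀ t, |t| < (n:ℝ) + 1 → |t| < (m:ℝ) + 1 → y n t = y m t := by
    intro n m t h1 h2
    rcases le_total n m with h | h
    · exact hcomp n m h t h1
    · exact (hcomp m n h t h2).symm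
  refine ⟨fun t => y ⌈|t|⌉₊ t, ?_, ?_⟩
  · exact hy0 _
  · intro t
    have h1 : |t| < (⌈|t|⌉₊ : ℝ) + 1 := (Nat.le_ceil _).trans_lt (lt_add_one _)
    refine (hy' _ t h1).congr_of_eventuallyEq ?_
    have : ∀ᶠ s in nhds t, |s| < (⌈|t|⌉₊ : ℝ) + 1 := continuous_abs.continuousAt.eventually_lt_const h1
    filter_upwards [this] with s hs
    exact hcomp2 _ _ s ((Nat.le_ceil _).trans_lt (lt_add_one _)) hs

lemma hrf_fderiv_comp {N : ℕ} [NeZero N] {G : (ZMod N → ℝ) → (ZMod N → ℝ)}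
    (hGdiff : Differentiable ℝ G) (V W : ZMod N → ℝ) (j : ZMod N) :
    fderiv ℝ (fun W => G W j) V W = fderiv ℝ G V W j := by
  rw [(hasFDerivAt_pi'.1 (hGdiff V).hasFDerivAt j).fderiv]
  rfl

lemma hrf_fderiv_sum {N : ℕ} [NeZero N] (L : (ZMod N → ℝ) →L[ℝ] (ZMod N → ℝ)) (W : ZMod N → ℝ) :
    L W = ∑ j, W j • L (Pi.single j 1) := by
  conv_lhs => rw [pi_eq_sum_univ' W]
  simp [map_sum]

lemma hrf_F2_dot {N : ℕ} [NeZero N] (G : (ZMod N → ℝ) → (ZMod N → ℝ)) (M U W : ZMod N → ℝ) :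
    ∑ j, W j * Ftilde2 G M U j = ∑ i, M i * fderiv ℝ G U W i := by
  unfold Ftilde2
  simp_rw [hrf_fderiv_sum (fderiv ℝ G U) W, Finset.mul_sum, Finset.sum_apply, Finset.mul_sum]
  rw [Finset.sum_comm]
  refine Finset.sum_congr rfl fun i _ => Finset.sum_congr rfl fun j _ => ?_
  simp only [Pi.smul_apply, smul_eq_mul]
  ring

lemma hrf_bregman {N : ℕ} [NeZero N] {G : (ZMod N → ℝ) → (ZMod N → ℝ)}
    (hGdiff : Differentiable ℝ G)
    (hGconv : ∀ j : ZMod N, ConvexOn ℝ Set.univ (fun U => G U j)) (U V : ZMod N → ℝ) (j : ZMod N) :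
    0 ≤ G U j - G V j - fderiv ℝ G V (U - V) j := by
  have hc : ConvexOn ℝ Set.univ ((fun U => G U j) ∘ (AffineMap.lineMap V U : ℝ →ᵃ[ℝ] _)) :=
    (hGconv j).comp_affineMap _
  have hd : HasDerivAt ((fun U => G U j) ∘ (AffineMap.lineMap V U : ℝ →ᵃ[ℝ] _)) (fderiv ℝ G V (U - V) j) 0 := by
    have h1 : HasFDerivAt (fun U => G U j) ((ContinuousLinearMap.proj j).comp (fderiv ℝ G V))
      ((AffineMap.lineMap V U : ℝ →ᵃ[ℝ] _) (0:ℝ)) := by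
      simpa using hasFDerivAt_pi'.1 (hGdiff V).hasFDerivAt j
    have := h1.comp_hasDerivAt (0:ℝ) (AffineMap.hasDerivAt_lineMap (a := V) (b := U) (x := (0:ℝ)))
    simpa using this
  have := hc.le_slope_of_hasDerivAt (Set.mem_univ 0) (Set.mem_univ 1) one_pos hd
  simp [slope_def_field] at this
  simpa using this

lemma hrf_F1_sum {N : ℕ} [NeZero N] (k : ℝ) (G : (ZMod N → ℝ) → (ZMod N → ℝ)) (M U : ZMod N → ℝ)
    (hM : ∑ i, M i ≠ 0) : ∑ i, M i * Ftilde1 k G M U i = 0 := by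
  have h1 : ∑ i, M i * Ftilde1 k G M U i = Htilde k G M U * ∑ i, M i -
      ∑ i, (M i * G U i - (1 / k) * (M i * Real.log (M i))) := by
    rw [Finset.mul_sum, ← Finset.sum_sub_distrib]
    refine Finset.sum_congr rfl fun i _ => ?_
    unfold Ftilde1; ring
  rw [h1]
  unfold Htilde
  rw [div_mul_cancel₀ _ hM, sub_self]

lemma hrf_poincare {N : ℕ} [NeZero N] (x : ZMod N → ℝ) (hx : ∑ j, x j = 0) :
    ∑ j, x j ^ 2 ≤ (N : ℝ) ^ 3 * ∑ j, (x j - x (j + 1)) ^ 2 := by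
  set D := ∑ j, (x j - x (j + 1)) ^ 2 with hD
  have hD0 : 0 ≤ D := Finset.sum_nonneg fun _ _ => sq_nonneg _
  have hN : (0:ℝ) < N := by exact_mod_cast NeZero.pos N
  have h1 : ∀ j, |x j - x (j + 1)| ≤ √D := fun j =>
    Real.abs_le_sqrt (Finset.single_le_sum (f := fun j => (x j - x (j + 1)) ^ 2)
      (fun _ _ => sq_nonneg _) (Finset.mem_univ j))
  have h2 : ∀ (n : ℕ) (j : ZMod N), |x j - x (j + n)| ≤ n * √D := by
    intro n j
    induction n with
    | zero => simp
    | succ n ih =>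
      have e : j + ((n + 1 : ℕ) : ZMod N) = (j + n) + 1 := by push_cast; ring
      rw [e]
      have := abs_sub_le (x j) (x (j + n)) (x (j + n + 1))
      have := h1 (j + n)
      push_cast
      linarith
  have h3 : ∀ i j, |x j - x i| ≤ N * √D := by
    intro i j
    have := h2 (i - j).val j
    rw [ZMod.natCast_zmod_val, add_sub_cancel] at this
    refine this.trans ?_
    gcongr
    exact (ZMod.val_lt _).le
  have h4 : ∀ j, x j ^ 2 ≤ (N:ℝ)^2 * D := by
    intro j
    have e : (N:ℝ) * x j = ∑ i, (x j - x i) := by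
      simp [Finset.sum_sub_distrib, hx, ZMod.card]
    have : |(N:ℝ) * x j| ≤ N * (N * √D) := by
      rw [e]
      refine (Finset.abs_sum_le_sum_abs _ _).trans ?_
      refine (Finset.sum_le_sum fun i _ => h3 i j).trans ?_
      simp [ZMod.card]
    rw [abs_mul, abs_of_pos hN] at this
    have h5 := le_of_mul_le_mul_left this hN
    calc x j ^ 2 = |x j| ^ 2 := (sq_abs _).symm
      _ ≤ (N * √D) ^ 2 := by gcongr
      _ = _ := by rw [mul_pow, Real.sq_sqrt hD0]
  calc _ ≤ ∑ j : ZMod N, (N:ℝ)^2 * D := Finset.sum_le_sum fun j _ => h4 j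
    _ = _ := by simp [ZMod.card]; ring

/-- The Lyapunov function in logarithmic variables. -/
noncomputable def hrfPhi {N : ℕ} [NeZero N] (Ms Us : ZMod N → ℝ)
    (y : (ZMod N → ℝ) × (ZMod N → ℝ)) : ℝ :=
  ∑ i, (Ms i * (Real.log (Ms i) - y.1 i) - Ms i + Real.exp (y.1 i)) +
    (1 / 2) * ∑ j, (y.2 j - Us j) ^ 2

/-- The vector field in logarithmic variables. -/
noncomputable def hrfV {N : ℕ} [NeZero N] (k : ℝ) (G : (ZMod N → ℝ) → (ZMod N → ℝ))
    (y : (ZMod N → ℝ) × (ZMod N → ℝ)) : (ZMod N → ℝ) × (ZMod N → ℝ) :=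
  (fun i => -Ftilde1 k G (fun i => Real.exp (y.1 i)) y.2 i,
   fun j => -Ftilde2 G (fun i => Real.exp (y.1 i)) y.2 j)

lemma hrf_KL_eq {m : ℝ} (hm : 0 < m) (p : ℝ) :
    m * (Real.log m - p) - m + Real.exp p =
      m * (Real.exp (p - Real.log m) - 1 - (p - Real.log m)) := by
  rw [Real.exp_sub, Real.exp_log hm]
  field_simp
  ring

lemma hrf_KL_nonneg {m : ℝ} (hm : 0 < m) (p : ℝ) :
    0 ≤ m * (Real.log m - p) - m + Real.exp p := by
  rw [hrf_KL_eq hm]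
  have := Real.add_one_le_exp (p - Real.log m)
  apply mul_nonneg hm.le
  linarith

lemma hrf_KL_le_sym {m : ℝ} (hm : 0 < m) (p : ℝ) :
    m * (Real.log m - p) - m + Real.exp p ≤ (Real.exp p - m) * (p - Real.log m) := by
  have h1 := Real.add_one_le_exp (Real.log m - p)
  rw [Real.exp_sub, Real.exp_log hm, le_div_iff₀ (Real.exp_pos p)] at h1
  linarith

lemma hrf_dissip {N : ℕ} [NeZero N] {k h : ℝ} (hk : 0 < k) (hh : 0 < h)
    {G : (ZMod N → ℝ) → (ZMod N → ℝ)}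
    (hGdiff : Differentiable ℝ G)
    (hGconv : ∀ j : ZMod N, ConvexOn ℝ Set.univ (fun U => G U j))
    (hpoin : ∃ ϱ : ℝ, 0 < ϱ ∧ ∀ U V : ZMod N → ℝ,
      ∑ j : ZMod N, ((U j - U (j + 1)) / h - (V j - V (j + 1)) / h) ^ 2
        ≤ ϱ * ∑ j : ZMod N,
            (G U j - G V j - fderiv ℝ (fun W => G W j) V (U - V)))
    {Mstar Ustar : ZMod N → ℝ}
    (hMstarpos : ∀ j, 0 < Mstar j)
    (hstarmass : ∑ j, Mstar j = N)
    (hstar1 : ∀ i, Ftilde1 k G Mstar Ustar i = 0)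
    (hstar2 : ∀ j, Ftilde2 G Mstar Ustar j = 0) :
    ∃ lam : ℝ, 0 < lam ∧ ∀ y : (ZMod N → ℝ) × (ZMod N → ℝ),
      ∑ i, Real.exp (y.1 i) = N → ∑ j, y.2 j = ∑ j, Ustar j →
      ∑ i, (Real.exp (y.1 i) - Mstar i) * (hrfV k G y).1 i +
        ∑ j, (y.2 j - Ustar j) * (hrfV k G y).2 j ≤ -lam * hrfPhi Mstar Ustar y := by
  obtain ⟨ϱ, hϱ, hP⟩ := hpoin
  have hN : (0:ℝ) < N := by exact_mod_cast NeZero.pos N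
  obtain ⟨i0, hi0⟩ := Finite.exists_min Mstar
  set μ := Mstar i0 with hμ
  have hμpos : 0 < μ := hMstarpos i0
  set c := μ / (ϱ * h^2 * (N:ℝ)^3) with hc
  have hcpos : 0 < c := by positivity
  refine ⟨min (1/k) (2*c), lt_min (by positivity) (by positivity), ?_⟩
  rintro ⟨p, U⟩ hmass hmean
  simp only at hmass hmean
  set lam := min (1/k) (2*c)
  set m : ZMod N → ℝ := fun i => Real.exp (p i) with hm
  have hB1 : ∀ i, 0 ≤ m i * (G Ustar i - G U i - fderiv ℝ G U (Ustar - U) i) := fun i =>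
    mul_nonneg (Real.exp_pos _).le (hrf_bregman hGdiff hGconv _ _ _)
  have hB2' := hrf_bregman hGdiff hGconv U Ustar
  have hU : ∑ j, (U j - Ustar j)^2 ≤ (1/c) * ∑ i, Mstar i * (G U i - G Ustar i - fderiv ℝ G Ustar (U - Ustar) i) := by
    have a1 := hrf_poincare (fun j => U j - Ustar j) (by simp [hmean])
    have a2 := hP U Ustar
    simp_rw [hrf_fderiv_comp hGdiff] at a2
    have a3 : ∑ j : ZMod N, ((U j - U (j + 1)) / h - (Ustar j - Ustar (j + 1)) / h) ^ 2 =
        (1/h^2) * ∑ j, (U j - Ustar j - (U (j+1) - Ustar (j+1)))^2 := by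
      rw [Finset.mul_sum]
      refine Finset.sum_congr rfl fun j _ => ?_
      field_simp
      ring
    have a4 : μ * ∑ i, (G U i - G Ustar i - fderiv ℝ G Ustar (U - Ustar) i) ≤
        ∑ i, Mstar i * (G U i - G Ustar i - fderiv ℝ G Ustar (U - Ustar) i) := by
      rw [Finset.mul_sum]
      exact Finset.sum_le_sum fun i _ => mul_le_mul_of_nonneg_right (hi0 i) (hB2' i)
    rw [a3] at a2
    set X := ∑ j, (U j - Ustar j - (U (j+1) - Ustar (j+1)))^2
    set Y := ∑ i, (G U i - G Ustar i - fderiv ℝ G Ustar (U - Ustar) i)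
    set Z := ∑ i, Mstar i * (G U i - G Ustar i - fderiv ℝ G Ustar (U - Ustar) i)
    have a5 : X ≤ h^2 * (ϱ * Y) := by
      rw [one_div, inv_mul_le_iff₀ (by positivity)] at a2
      exact a2
    have a6 : Y ≤ Z / μ := by rw [le_div_iff₀ hμpos]; linarith
    calc _ ≤ (N:ℝ)^3 * X := a1
      _ ≤ (N:ℝ)^3 * (h^2 * (ϱ * (Z/μ))) := by gcongr; exact a5.trans (by gcongr)
      _ = _ := by rw [hc]; field_simp
  have hKL : ∑ i, (Mstar i * (Real.log (Mstar i) - p i) - Mstar i + m i) ≤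
      ∑ i, (m i - Mstar i) * (p i - Real.log (Mstar i)) :=
    Finset.sum_le_sum fun i _ => hrf_KL_le_sym (hMstarpos i) (p i)
  have hKL0 : 0 ≤ ∑ i, (Mstar i * (Real.log (Mstar i) - p i) - Mstar i + m i) :=
    Finset.sum_nonneg fun i _ => hrf_KL_nonneg (hMstarpos i) (p i)
  have hid : ∑ i, (m i - Mstar i) * (hrfV k G (p, U)).1 i +
        ∑ j, (U j - Ustar j) * (hrfV k G (p, U)).2 j =
      - (1/k) * ∑ i, (m i - Mstar i) * (p i - Real.log (Mstar i))
      - ∑ i, m i * (G Ustar i - G U i - fderiv ℝ G U (Ustar - U) i)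
      - ∑ i, Mstar i * (G U i - G Ustar i - fderiv ℝ G Ustar (U - Ustar) i) := by
    have b1 : ∑ j, (U j - Ustar j) * (hrfV k G (p, U)).2 j = - ∑ i, m i * fderiv ℝ G U (U - Ustar) i := by
      rw [← hrf_F2_dot, ← Finset.sum_neg_distrib]
      refine Finset.sum_congr rfl fun j _ => ?_
      simp only [hrfV, Pi.sub_apply, hm]; ring
    have b2 : ∑ i, Mstar i * fderiv ℝ G Ustar (U - Ustar) i = 0 := by
      rw [← hrf_F2_dot]; simp [hstar2]
    have b3 : ∀ i, (hrfV k G (p, U)).1 i = G U i - G Ustar i - (1/k) * (p i - Real.log (Mstar i))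
        + (Htilde k G Mstar Ustar - Htilde k G m U) := by
      intro i
      have := hstar1 i
      simp only [hrfV, Ftilde1, Real.log_exp] at this ⊢
      simp only [hm]
      linear_combination (-1 : ℝ) * this
    have b4 : fderiv ℝ G U (Ustar - U) = - fderiv ℝ G U (U - Ustar) := by
      rw [← map_neg, neg_sub]
    have b5 : ∑ i, (m i - Mstar i) = 0 := by
      rw [Finset.sum_sub_distrib, hstarmass, hmass, sub_self]
    have b6 : ∑ i, (m i - Mstar i) * (hrfV k G (p, U)).1 i =
       ∑ i, (m i - Mstar i) * (G U i - G Ustar i - (1/k) * (p i - Real.log (Mstar i))) := by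
      simp_rw [b3, mul_add, Finset.sum_add_distrib, ← Finset.sum_mul, b5, zero_mul, add_zero]
    rw [b1, b6, b4]
    have b7 : ∑ i, Mstar i * (G U i - G Ustar i - fderiv ℝ G Ustar (U - Ustar) i) =
      ∑ i, Mstar i * (G U i - G Ustar i) := by
      simp_rw [mul_sub _ _ (fderiv ℝ G Ustar (U - Ustar) _)]
      rw [Finset.sum_sub_distrib, b2, sub_zero]
    rw [b7, Finset.mul_sum, ← Finset.sum_neg_distrib, ← Finset.sum_add_distrib, ← Finset.sum_sub_distrib,
      ← Finset.sum_sub_distrib]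
    refine Finset.sum_congr rfl fun i _ => ?_
    simp only [Pi.neg_apply]
    ring
  change ∑ i, (m i - Mstar i) * (hrfV k G (p, U)).1 i +
        ∑ j, (U j - Ustar j) * (hrfV k G (p, U)).2 j ≤ _
  rw [hid]
  have hB1s := Finset.sum_nonneg fun i (_ : i ∈ Finset.univ) => hB1 i
  have hPhi : hrfPhi Mstar Ustar (p, U) = ∑ i, (Mstar i * (Real.log (Mstar i) - p i) - Mstar i + m i) +
    (1/2) * ∑ j, (U j - Ustar j)^2 := rfl
  rw [hPhi]
  set A := ∑ i, (Mstar i * (Real.log (Mstar i) - p i) - Mstar i + m i)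
  set A' := ∑ i, (m i - Mstar i) * (p i - Real.log (Mstar i))
  set X := ∑ j, (U j - Ustar j)^2
  set Z := ∑ i, Mstar i * (G U i - G Ustar i - fderiv ℝ G Ustar (U - Ustar) i)
  have hX0 : 0 ≤ X := Finset.sum_nonneg fun _ _ => sq_nonneg _
  have e1 : lam * A ≤ (1/k) * A' := by
    have : lam * A ≤ (1/k) * A := mul_le_mul_of_nonneg_right (min_le_left _ _) hKL0
    refine this.trans ?_
    gcongr
  have e2 : lam * ((1/2) * X) ≤ Z := by
    have : lam * ((1/2) * X) ≤ (2*c) * ((1/2)*X) := mul_le_mul_of_nonneg_right (min_le_right _ _) (by positivity)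
    refine this.trans ?_
    rw [one_div, ← div_eq_inv_mul, le_div_iff₀ hcpos] at hU
    linarith
  linarith

lemma hrf_V_locLip {N : ℕ} [NeZero N] (k : ℝ) {G : (ZMod N → ℝ) → (ZMod N → ℝ)}
    (hGdiff : Differentiable ℝ G)
    (hGlip : ∀ i j : ZMod N,
      LocallyLipschitz (fun U => (fderiv ℝ G U) (Pi.single j 1) i)) :
    LocallyLipschitz (hrfV k G) := by
  have hGc : ContDiff ℝ 1 G := by
    rw [contDiff_one_iff_fderiv]
    refine ⟨hGdiff, continuous_clm_apply.2 fun W => ?_⟩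
    simp_rw [hrf_fderiv_sum _ W]
    refine continuous_finsetSum _ fun j _ => ?_
    have hj : Continuous (fun U => (fderiv ℝ G U) (Pi.single j 1)) :=
      continuous_pi fun i => (hGlip i j).continuous
    exact hj.const_smul (W j)
  have hA : LocallyLipschitz (fun U : ZMod N → ℝ => fun i j : ZMod N => (fderiv ℝ G U) (Pi.single j 1) i) :=
    hrf_locLip_pi fun i => hrf_locLip_pi fun j => hGlip i j
  let Ψ : ((ZMod N → ℝ) × (ZMod N → ℝ)) × ((ZMod N → ℝ) × (ZMod N → ZMod N → ℝ)) →
      (ZMod N → ℝ) × (ZMod N → ℝ) := fun z =>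
    (fun i => -(-(z.2.1 i) + (∑ i, (Real.exp (z.1.1 i) * z.2.1 i -
        (1/k) * (Real.exp (z.1.1 i) * z.1.1 i))) / (∑ i, Real.exp (z.1.1 i)) + (1/k) * z.1.1 i),
     fun j => -∑ i, Real.exp (z.1.1 i) * z.2.2 i j)
  have hΨ : ContDiff ℝ 1 Ψ := by
    have hne : ∀ z : ((ZMod N → ℝ) × (ZMod N → ℝ)) × ((ZMod N → ℝ) × (ZMod N → ZMod N → ℝ)),
        ∑ i, Real.exp (z.1.1 i) ≠ 0 := fun z =>
      (Finset.sum_pos (fun i _ => Real.exp_pos _) Finset.univ_nonempty).ne'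
    refine ContDiff.prodMk ?_ ?_
    · refine contDiff_pi' fun i => ?_
      refine ContDiff.neg (ContDiff.add (ContDiff.add (by fun_prop) (ContDiff.div ?_ ?_ hne)) (by fun_prop))
      · fun_prop
      · fun_prop
    · refine contDiff_pi' fun j => ?_
      fun_prop
  have hin : LocallyLipschitz (fun y : (ZMod N → ℝ) × (ZMod N → ℝ) =>
      (y, (G y.2, fun i j : ZMod N => (fderiv ℝ G y.2) (Pi.single j 1) i))) := by
    have hs : LocallyLipschitz (Prod.snd : (ZMod N → ℝ) × (ZMod N → ℝ) → ZMod N → ℝ) :=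
      LipschitzWith.prod_snd.locallyLipschitz
    exact LocallyLipschitz.id.prodMk ((hGc.locallyLipschitz.comp hs).prodMk (hA.comp hs))
  have := hΨ.locallyLipschitz.comp hin
  have he : hrfV k G = Ψ ∘ (fun y : (ZMod N → ℝ) × (ZMod N → ℝ) =>
      (y, (G y.2, fun i j : ZMod N => (fderiv ℝ G y.2) (Pi.single j 1) i))) := by
    funext y
    simp only [Ψ, hrfV, Ftilde1, Ftilde2, Htilde, Function.comp, Real.log_exp]
  rw [he]
  exact this

lemma hrf_Phi_contDiff {N : ℕ} [NeZero N] (Ms Us : ZMod N → ℝ) : ContDiff ℝ 1 (hrfPhi Ms Us) := by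
  unfold hrfPhi
  fun_prop

lemma hrf_Phi_bound {N : ℕ} [NeZero N] {Ms Us : ZMod N → ℝ} (hMs : ∀ i, 0 < Ms i) (C : ℝ) :
    ∃ R : ℝ, ∀ y, hrfPhi Ms Us y ≤ C → ‖y‖ ≤ R := by
  obtain ⟨i1, h1⟩ := Finite.exists_max fun i => |Real.log (Ms i)| + C / Ms i + 1
  obtain ⟨i2, h2⟩ := Finite.exists_max fun i => |Us i| + C + 1
  refine ⟨max 0 (max (|Real.log (Ms i1)| + C / Ms i1 + 1) (|Us i2| + C + 1)), ?_⟩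
  rintro ⟨p, U⟩ hy
  set R := max 0 (max (|Real.log (Ms i1)| + C / Ms i1 + 1) (|Us i2| + C + 1))
  have hR0 : 0 ≤ R := le_max_left _ _
  have hA0 : ∀ i, 0 ≤ Ms i * (Real.log (Ms i) - p i) - Ms i + Real.exp (p i) := fun i =>
    hrf_KL_nonneg (hMs i) _
  have hA := Finset.sum_nonneg fun i (_ : i ∈ Finset.univ) => hA0 i
  have hX : 0 ≤ ∑ j, (U j - Us j)^2 := Finset.sum_nonneg fun _ _ => sq_nonneg _
  unfold hrfPhi at hy
  simp only at hy
  have hp : ∀ i, |p i| ≤ R := by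
    intro i
    refine le_trans ?_ ((h1 i).trans ((le_max_left _ _).trans (le_max_right _ _)))
    have e1 := Finset.single_le_sum (f := fun i => Ms i * (Real.log (Ms i) - p i) - Ms i + Real.exp (p i))
      (fun i _ => hA0 i) (Finset.mem_univ i)
    have e2 : Ms i * (Real.log (Ms i) - p i) - Ms i + Real.exp (p i) ≤ C := by
      linarith
    rw [hrf_KL_eq (hMs i)] at e2
    set q := p i - Real.log (Ms i) with hq
    have e3 : Real.exp q - 1 - q ≤ C / Ms i := by
      rw [le_div_iff₀ (hMs i)]; linarith
    have e4 : |q| - 1 ≤ Real.exp q - 1 - q := by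
      rcases le_total 0 q with h | h
      · rw [abs_of_nonneg h]
        have := Real.quadratic_le_exp_of_nonneg h
        nlinarith [sq_nonneg (q - 1)]
      · rw [abs_of_nonpos h]
        linarith [Real.exp_pos q]
    have e5 : |p i| ≤ |Real.log (Ms i)| + |q| := by
      have : p i = Real.log (Ms i) + q := by rw [hq]; ring
      rw [this]; exact abs_add_le _ _
    linarith
  have hu : ∀ j, |U j| ≤ R := by
    intro j
    refine le_trans ?_ ((h2 j).trans ((le_max_right _ _).trans (le_max_right _ _)))
    have e1 := Finset.single_le_sum (f := fun j => (U j - Us j)^2)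
      (fun i _ => sq_nonneg _) (Finset.mem_univ j)
    have e2 : (U j - Us j)^2 ≤ 2 * C := by linarith
    have e3 : |U j - Us j| ≤ C + 1 := by
      rw [← sq_abs] at e2
      nlinarith [sq_nonneg (|U j - Us j| - 1)]
    have e5 : |U j| ≤ |Us j| + |U j - Us j| := by
      have : U j = Us j + (U j - Us j) := by ring
      rw [this]; simpa using abs_add_le (Us j) (U j - Us j)
    linarith
  rw [Prod.norm_def]
  exact max_le ((pi_norm_le_iff_of_nonneg hR0).2 hp) ((pi_norm_le_iff_of_nonneg hR0).2 hu)

lemma hrf_Phi_deriv {N : ℕ} [NeZero N] (Ms Us : ZMod N → ℝ)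
    {y : ℝ → (ZMod N → ℝ) × (ZMod N → ℝ)} {y' : (ZMod N → ℝ) × (ZMod N → ℝ)} {t : ℝ}
    (hy : HasDerivAt y y' t) :
    HasDerivAt (fun t => hrfPhi Ms Us (y t))
      (∑ i, (Real.exp ((y t).1 i) - Ms i) * y'.1 i + ∑ j, ((y t).2 j - Us j) * y'.2 j) t := by
  have h1 : ∀ i, HasDerivAt (fun t => (y t).1 i) (y'.1 i) t := hasDerivAt_pi.1 hy.fst
  have h2 : ∀ i, HasDerivAt (fun t => (y t).2 i) (y'.2 i) t := hasDerivAt_pi.1 hy.snd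
  unfold hrfPhi
  have a1 : HasDerivAt (fun t => ∑ i, (Ms i * (Real.log (Ms i) - (y t).1 i) - Ms i + Real.exp ((y t).1 i)))
    (∑ i, (Real.exp ((y t).1 i) - Ms i) * y'.1 i) t := by
    refine HasDerivAt.fun_sum fun i _ => ?_
    have := ((((h1 i).const_sub (Real.log (Ms i))).const_mul (Ms i)).sub_const (Ms i)).add (h1 i).exp
    refine this.congr_deriv ?_
    ring
  have a2 : HasDerivAt (fun t => (1/2:ℝ) * ∑ j, ((y t).2 j - Us j)^2)
    (∑ j, ((y t).2 j - Us j) * y'.2 j) t := by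
    have : HasDerivAt (fun t => ∑ j, ((y t).2 j - Us j)^2) (∑ j, 2 * (((y t).2 j - Us j) * y'.2 j)) t := by
      refine HasDerivAt.fun_sum fun i _ => ?_
      refine (((h2 i).sub_const (Us i)).pow 2).congr_deriv ?_
      simp; ring
    refine (this.const_mul (1/2)).congr_deriv ?_
    rw [← Finset.mul_sum]; ring
  exact a1.add a2

lemma hrf_KL_sqrt {m : ℝ} (hm : 0 < m) (p : ℝ) :
    m * (Real.exp ((p - Real.log m) / 2) - 1) ^ 2 ≤ m * (Real.log m - p) - m + Real.exp p := by
  rw [hrf_KL_eq hm]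
  apply mul_le_mul_of_nonneg_left _ hm.le
  have h1 := Real.add_one_le_exp ((p - Real.log m) / 2)
  have h2 : Real.exp (p - Real.log m) = Real.exp ((p - Real.log m) / 2) ^ 2 := by
    rw [← Real.exp_nat_mul]; congr 1; push_cast; ring
  rw [h2]
  nlinarith

lemma hrf_trans {N : ℕ} [NeZero N] {G : (ZMod N → ℝ) → (ZMod N → ℝ)}
    (hGdiff : Differentiable ℝ G)
    (hGtrans : ∀ (U : ZMod N → ℝ) (s : ℝ) (j : ZMod N), G (U + fun _ => s) j = G U j)
    (M U : ZMod N → ℝ) : ∑ j, Ftilde2 G M U j = 0 := by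
  have h1 := hrf_F2_dot G M U (fun _ => 1)
  simp only [one_mul] at h1
  rw [h1]
  have h2 : fderiv ℝ G U (fun _ => 1) = 0 := by
    have a := ((hGdiff U).hasFDerivAt.hasLineDerivAt (fun _ => 1))
    unfold HasLineDerivAt at a
    have b : (fun t : ℝ => G (U + t • fun _ => 1)) = fun _ => G U := by
      funext t
      ext j
      have := hGtrans U t j
      rw [← this]
      congr 2
      ext; simp
    rw [b] at a
    exact a.unique (hasDerivAt_const _ _)
  simp [h2]

set_option maxHeartbeats 2000000 in
/-- global existence, uniqueness (among positive solutions) and convergence of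
the discrete Hessian Riemannian flow `(Ṁ,U̇) = −F̄(M,U)` on `[0,∞)`: for any positive
mass-one initial condition with `∑ u⁰ⱼ = ∑ u*ⱼ`, there is a unique positive solution, and
it converges to the stationary solution `(M*,U*)` of `F̃ = 0` as `t → ∞`. -/
theorem discrete_HRF_existence_uniqueness_convergence
    (N : ℕ) [NeZero N] (k h : ℝ) (hk : 0 < k) (hh : 0 < h)
    (G : (ZMod N → ℝ) → (ZMod N → ℝ))
    (hGdiff : Differentiable ℝ G)
    (hGconv : ∀ j : ZMod N, ConvexOn ℝ Set.univ (fun U => G U j))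
    (hGlip : ∀ i j : ZMod N,
      LocallyLipschitz (fun U => (fderiv ℝ G U) (Pi.single j 1) i))
    (hpoin : ∃ ϱ : ℝ, 0 < ϱ ∧ ∀ U V : ZMod N → ℝ,
      ∑ j : ZMod N, ((U j - U (j + 1)) / h - (V j - V (j + 1)) / h) ^ 2
        ≤ ϱ * ∑ j : ZMod N,
            (G U j - G V j - fderiv ℝ (fun W => G W j) V (U - V)))
    (hGtrans : ∀ (U : ZMod N → ℝ) (s : ℝ) (j : ZMod N), G (U + fun _ => s) j = G U j)
    (Mstar Ustar : ZMod N → ℝ)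
    (hMstarpos : ∀ j, 0 < Mstar j)
    (hstarmass : (1 / (N : ℝ)) * ∑ j, Mstar j = 1)
    (hstar1 : ∀ i, Ftilde1 k G Mstar Ustar i = 0)
    (hstar2 : ∀ j, Ftilde2 G Mstar Ustar j = 0)
    (M0 U0 : ZMod N → ℝ)
    (hM0pos : ∀ j, 0 < M0 j)
    (hM0mass : (1 / (N : ℝ)) * ∑ j, M0 j = 1)
    (hU0mean : ∑ j, U0 j = ∑ j, Ustar j) :
    ∃ M U : ℝ → ZMod N → ℝ,
      (M 0 = M0 ∧ U 0 = U0) ∧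
      (∀ t, 0 ≤ t → ∀ j, 0 < M t j) ∧
      (∀ t, 0 ≤ t → ∀ j,
        HasDerivAt (fun s => M s j) (-(Fbar1 k G (M t) (U t) j)) t ∧
        HasDerivAt (fun s => U s j) (-(Ftilde2 G (M t) (U t) j)) t) ∧
      (∀ M' U' : ℝ → ZMod N → ℝ,
        (M' 0 = M0 ∧ U' 0 = U0) →
        (∀ t, 0 ≤ t → ∀ j, 0 < M' t j) →
        (∀ t, 0 ≤ t → ∀ j,
          HasDerivAt (fun s => M' s j) (-(Fbar1 k G (M' t) (U' t) j)) t ∧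
          HasDerivAt (fun s => U' s j) (-(Ftilde2 G (M' t) (U' t) j)) t) →
        ∀ t, 0 ≤ t → M' t = M t ∧ U' t = U t) ∧
      (∀ j : ZMod N,
        Tendsto (fun t => U t j) atTop (nhds (Ustar j)) ∧
        Tendsto (fun t => M t j) atTop (nhds (Mstar j))) := by
  have hN : (0:ℝ) < N := by exact_mod_cast NeZero.pos N
  have hmass : ∀ M : ZMod N → ℝ, (1 / (N : ℝ)) * ∑ j, M j = 1 → ∑ j, M j = N := by
    intro M hM
    field_simp at hM
    exact hM
  obtain ⟨lam, hlam, hdis⟩ := hrf_dissip hk hh hGdiff hGconv hpoin hMstarpos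
    (hmass _ hstarmass) hstar1 hstar2
  set x0 : (ZMod N → ℝ) × (ZMod N → ℝ) := (fun i => Real.log (M0 i), U0) with hx0
  set Φ := hrfPhi Mstar Ustar with hΦ
  set v := hrfV k G with hv
  have hvlip : LocallyLipschitz v := hrf_V_locLip k hGdiff hGlip
  have hΦnn : ∀ y, 0 ≤ Φ y := by
    intro y
    rw [hΦ]; unfold hrfPhi
    have := Finset.sum_nonneg fun i (_ : i ∈ Finset.univ) => hrf_KL_nonneg (hMstarpos i) (y.1 i)
    have h2 : 0 ≤ ∑ j, (y.2 j - Ustar j)^2 := Finset.sum_nonneg fun _ _ => sq_nonneg _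
    linarith
  set χ : (ZMod N → ℝ) × (ZMod N → ℝ) → ℝ := fun y => Real.smoothTransition (Φ x0 + 2 - Φ y) with hχ
  have hχc : ContDiff ℝ 1 χ :=
    (Real.smoothTransition.contDiff (n := 1)).comp (contDiff_const.sub (hrf_Phi_contDiff Mstar Ustar))
  set w : (ZMod N → ℝ) × (ZMod N → ℝ) → (ZMod N → ℝ) × (ZMod N → ℝ) := fun y => χ y • v y with hw
  have hwlip : LocallyLipschitz w := by
    rw [hw]
    exact hrf_locLip_smul hχc.locallyLipschitz hvlip
  obtain ⟨L, hL⟩ : ∃ L : NNReal, ∀ y, ‖w y‖ ≤ L := by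
    obtain ⟨R, hR⟩ := hrf_Phi_bound (Us := Ustar) hMstarpos (Φ x0 + 2)
    obtain ⟨C, hC⟩ := (isCompact_closedBall (0 : (ZMod N → ℝ) × (ZMod N → ℝ)) R).exists_bound_of_continuousOn
      hwlip.continuous.continuousOn
    refine ⟨C.toNNReal, fun y => ?_⟩
    by_cases hy : Φ y ≤ Φ x0 + 2
    · exact (hC y (by simpa using hR y hy)).trans (Real.le_coe_toNNReal C)
    · have : w y = 0 := by
        simp only [hw, hχ]
        rw [Real.smoothTransition.zero_of_nonpos (by linarith), zero_smul]
      rw [this, norm_zero]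
      exact NNReal.coe_nonneg _
  obtain ⟨y, hy0, hy⟩ := hrf_ode_global hwlip L hL x0
  have hp : ∀ t i, HasDerivAt (fun t => (y t).1 i) (χ (y t) * (v (y t)).1 i) t := fun t =>
    hasDerivAt_pi.1 (hy t).fst
  have hu : ∀ t i, HasDerivAt (fun t => (y t).2 i) (χ (y t) * (v (y t)).2 i) t := fun t =>
    hasDerivAt_pi.1 (hy t).snd
  -- conservation laws
  have hmassc : ∀ t, ∑ i, Real.exp ((y t).1 i) = N := by
    intro t
    have hd : ∀ t, HasDerivAt (fun t => ∑ i, Real.exp ((y t).1 i)) 0 t := by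
      intro t
      refine (HasDerivAt.fun_sum fun i _ => (hp t i).exp).congr_deriv ?_
      have h1 := hrf_F1_sum k G (fun i => Real.exp ((y t).1 i)) (y t).2
        (Finset.sum_pos (fun i _ => Real.exp_pos _) Finset.univ_nonempty).ne'
      have h2 : ∑ i, Real.exp ((y t).1 i) * (χ (y t) * (v (y t)).1 i) = -χ (y t) *
          ∑ i, Real.exp ((y t).1 i) * Ftilde1 k G (fun i => Real.exp ((y t).1 i)) (y t).2 i := by
        rw [Finset.mul_sum]
        refine Finset.sum_congr rfl fun i _ => ?_
        simp only [hv, hrfV]; ring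
      rw [h2, h1, mul_zero]
    rw [is_const_of_deriv_eq_zero (fun t => (hd t).differentiableAt) (fun t => (hd t).deriv) t 0]
    rw [hy0, hx0, ← hmass _ hM0mass]
    exact Finset.sum_congr rfl fun i _ => Real.exp_log (hM0pos i)
  have hmeanc : ∀ t, ∑ i, (y t).2 i = ∑ j, Ustar j := by
    intro t
    have hd : ∀ t, HasDerivAt (fun t => ∑ i, (y t).2 i) 0 t := by
      intro t
      refine (HasDerivAt.fun_sum fun i _ => hu t i).congr_deriv ?_
      rw [← Finset.mul_sum]
      simp only [hv, hrfV, Finset.sum_neg_distrib]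
      rw [hrf_trans hGdiff hGtrans]; simp
    rw [is_const_of_deriv_eq_zero (fun t => (hd t).differentiableAt) (fun t => (hd t).deriv) t 0]
    rw [hy0, hx0, ← hU0mean]
  -- Lyapunov function
  have hΦd : ∀ t, ∃ q, HasDerivAt (fun t => Φ (y t)) (χ (y t) * q) t ∧ q ≤ -lam * Φ (y t) := by
    intro t
    refine ⟨_, (hrf_Phi_deriv Mstar Ustar (hy t)).congr_deriv ?_, hdis (y t) (hmassc t) (hmeanc t)⟩
    rw [mul_add, Finset.mul_sum, Finset.mul_sum]
    congr 1
    · refine Finset.sum_congr rfl fun i _ => ?_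
      simp only [hw, Prod.smul_fst, Pi.smul_apply, smul_eq_mul]; ring
    · refine Finset.sum_congr rfl fun i _ => ?_
      simp only [hw, Prod.smul_snd, Pi.smul_apply, smul_eq_mul]; ring
  choose q hq hqle using hΦd
  have hanti : Antitone (fun t => Φ (y t)) := by
    refine antitone_of_deriv_nonpos (fun t => (hq t).differentiableAt) fun t => ?_
    rw [(hq t).deriv]
    refine mul_nonpos_of_nonneg_of_nonpos (Real.smoothTransition.nonneg _) ((hqle t).trans ?_)
    have := mul_nonneg hlam.le (hΦnn (y t))
    linarith
  have hχ1 : ∀ t, 0 ≤ t → χ (y t) = 1 := by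
    intro t ht
    have := hanti ht
    simp only [hy0] at this
    exact Real.smoothTransition.one_of_one_le (by linarith)
  have hyv : ∀ t, 0 ≤ t → HasDerivAt y (v (y t)) t := by
    intro t ht
    have := hy t
    simp only [hw, hχ1 t ht, one_smul] at this
    exact this
  have hdecay : ∀ t, 0 ≤ t → Φ (y t) ≤ Φ x0 * Real.exp (-lam * t) := by
    have hE : ∀ t, HasDerivAt (fun t => Real.exp (lam * t)) (Real.exp (lam * t) * lam) t := by
      intro t
      simpa using ((hasDerivAt_id t).const_mul lam).exp
    have hd : ∀ t, HasDerivAt (fun t => Real.exp (lam * t) * Φ (y t))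
        (Real.exp (lam * t) * lam * Φ (y t) + Real.exp (lam * t) * (χ (y t) * q t)) t :=
      fun t => (hE t).mul (hq t)
    have ha : AntitoneOn (fun t => Real.exp (lam * t) * Φ (y t)) (Set.Ici 0) := by
      refine antitoneOn_of_deriv_nonpos (convex_Ici 0) (fun t _ => (hd t).continuousAt.continuousWithinAt)
        (fun t _ => (hd t).differentiableAt.differentiableWithinAt) fun t ht => ?_
      rw [interior_Ici] at ht
      rw [(hd t).deriv, hχ1 t (le_of_lt ht), one_mul]
      have := mul_le_mul_of_nonneg_left (hqle t) (Real.exp_pos (lam * t)).le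
      linarith
    intro t ht
    have := ha (Set.mem_Ici.2 le_rfl) (Set.mem_Ici.2 ht) ht
    simp only [mul_zero, Real.exp_zero, one_mul, hy0] at this
    rw [neg_mul, Real.exp_neg, ← div_eq_mul_inv, le_div_iff₀ (Real.exp_pos _)]
    linarith
  have hΦ0 : Tendsto (fun t => Φ (y t)) atTop (nhds 0) := by
    have h1 : Tendsto (fun t => Φ x0 * Real.exp (-lam * t)) atTop (nhds 0) := by
      have h2 : Tendsto (fun t => lam * t) atTop atTop := tendsto_id.const_mul_atTop hlam
      have := (Real.tendsto_exp_neg_atTop_nhds_zero.comp h2).const_mul (Φ x0)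
      simpa [Function.comp_def] using this
    refine squeeze_zero' (Eventually.of_forall fun t => hΦnn _) ?_ h1
    filter_upwards [eventually_ge_atTop 0] with t ht using hdecay t ht
  refine ⟨fun t i => Real.exp ((y t).1 i), fun t => (y t).2, ⟨?_, ?_⟩, ?_, ?_, ?_, ?_⟩
  · funext i
    simp only [hy0, hx0]
    exact Real.exp_log (hM0pos i)
  · simp only [hy0, hx0]
  · intro t _ j
    exact Real.exp_pos _
  · intro t ht j
    constructor
    · refine (hp t j).exp.congr_deriv ?_
      rw [hχ1 t ht]
      simp only [hv, hrfV, Fbar1]; ring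
    · refine (hu t j).congr_deriv ?_
      rw [hχ1 t ht]
      simp only [hv, hrfV]; ring
  · intro M' U' h0 hpos hsol
    set z : ℝ → (ZMod N → ℝ) × (ZMod N → ℝ) := fun t => (fun i => Real.log (M' t i), U' t) with hz
    have hexp : ∀ t, 0 ≤ t → (fun i => Real.exp ((z t).1 i)) = M' t := fun t ht =>
      funext fun i => Real.exp_log (hpos t ht i)
    have hzd : ∀ t, 0 ≤ t → HasDerivAt z (v (z t)) t := by
      intro t ht
      have e : v (z t) = (fun i => -Ftilde1 k G (M' t) (U' t) i, fun j => -Ftilde2 G (M' t) (U' t) j) := by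
        simp only [hv, hrfV]
        rw [hexp t ht]
      rw [e]
      refine HasDerivAt.prodMk (hasDerivAt_pi.2 fun i => ?_) (hasDerivAt_pi.2 fun j => (hsol t ht j).2)
      refine ((hsol t ht i).1.log (hpos t ht i).ne').congr_deriv ?_
      have := (hpos t ht i).ne'
      unfold Fbar1
      field_simp
    have hzy := hrf_ode_unique_right hvlip hzd hyv (by rw [hy0, hx0, hz]; simp only [h0.1, h0.2])
    intro t ht
    refine ⟨?_, ?_⟩
    · rw [← hexp t ht, hzy t ht]
    · exact congrArg Prod.snd (hzy t ht)
  · intro j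
    have hbU : ∀ t, (1/2) * ((y t).2 j - Ustar j)^2 ≤ Φ (y t) := by
      intro t
      have h1 := Finset.sum_nonneg fun i (_ : i ∈ Finset.univ) => hrf_KL_nonneg (hMstarpos i) ((y t).1 i)
      have h2 := Finset.single_le_sum (f := fun j => ((y t).2 j - Ustar j)^2)
        (fun i _ => sq_nonneg _) (Finset.mem_univ j)
      rw [hΦ]; unfold hrfPhi
      linarith
    have hbM : ∀ t, Mstar j * (Real.exp (((y t).1 j - Real.log (Mstar j)) / 2) - 1) ^ 2 ≤ Φ (y t) := by
      intro t
      have h1 : 0 ≤ ∑ j, ((y t).2 j - Ustar j)^2 := Finset.sum_nonneg fun _ _ => sq_nonneg _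
      have h2 := Finset.single_le_sum
        (f := fun i => Mstar i * (Real.log (Mstar i) - (y t).1 i) - Mstar i + Real.exp ((y t).1 i))
        (fun i _ => hrf_KL_nonneg (hMstarpos i) ((y t).1 i)) (Finset.mem_univ j)
      have h3 := hrf_KL_sqrt (hMstarpos j) ((y t).1 j)
      rw [hΦ]; unfold hrfPhi
      linarith
    have hsq : ∀ (g : ℝ → ℝ) (c : ℝ), 0 < c → (∀ t, c * g t ^ 2 ≤ Φ (y t)) → Tendsto g atTop (nhds 0) := by
      intro g c hc hg
      have h1 : Tendsto (fun t => g t ^ 2) atTop (nhds 0) := by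
        refine squeeze_zero (fun t => sq_nonneg _) (g := fun t => Φ (y t) / c) (fun t => ?_) ?_
        · rw [le_div_iff₀ hc]; linarith [hg t]
        · simpa using hΦ0.div_const c
      have h2 := h1.sqrt
      simp only [Real.sqrt_sq_eq_abs, Real.sqrt_zero] at h2
      exact (tendsto_zero_iff_abs_tendsto_zero _).2 h2
    constructor
    · have := (hsq _ _ (by norm_num) hbU).add_const (Ustar j)
      simpa using this
    · have h1 := (hsq _ _ (hMstarpos j) hbM).add_const 1
      have h2 := (h1.pow 2).const_mul (Mstar j)
      simp only [sub_add_cancel, zero_add, one_pow, mul_one] at h2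
      refine h2.congr fun t => ?_
      rw [← Real.exp_nat_mul]
      have : ((2:ℕ):ℝ) * (((y t).1 j - Real.log (Mstar j)) / 2) = (y t).1 j - Real.log (Mstar j) := by
        push_cast; ring
      rw [this, Real.exp_sub, Real.exp_log (hMstarpos j)]
      have := (hMstarpos j).ne'
      field_simp
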